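/- (Interval-to-point optimisation, Lemma 2.) Let p, q ∈ Δ_d with all p_i > 0 and p ⊥_γ q, and let L = {x ∈ (0,1) : f_p(x) < f_q(x)}. Let π be a permutation β-ordering p, set Γ_l = Σ_{i≤l} γ_{π(i)}, and let L' = {l ∈ {1,…,d−1} : f_p(Γ_l) < f_q(Γ_l)}. If L' is nonempty, then sup_{x ∈ L} f'_p(x⁻)/f'_p(x⁺) = max_{l ∈ L'} s_l(p)/s_{l+1}(p), where s_1(p) ≥ … ≥ s_d(p) are the β-ordered slopes s_l(p) = p_{π(l)}/γ_{π(l)}, and f'_p(x⁻), f'_p(x⁺) denote one-sided derivatives of the piecewise-linear curve f_p. -/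

import Mathlib

open scoped BigOperators Classical

/-- `p` is a probability distribution on the finite index type `ι`. -/
def IsDist {ι : Type*} [Fintype ι] (p : ι → ℝ) : Prop :=
  (∀ i, 0 ≤ p i) ∧ ∑ i, p i = 1

/-- `p` thermomajorises `q` relative to the Gibbs distribution `γ`. -/
def ThermoMaj {ι : Type*} [Fintype ι] (γ p q : ι → ℝ) : Prop :=
  ∀ t : ℝ, 0 ≤ t → ∑ i, max (q i - t * γ i) 0 ≤ ∑ i, max (p i - t * γ i) 0

/-- Thermomajorisation curve `f_p(x) = min_{t ≥ 0} (t·x + Σ_i max(p_i − t·γ_i, 0))`. -/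
noncomputable def tCurve {ι : Type*} [Fintype ι] (γ p : ι → ℝ) (x : ℝ) : ℝ :=
  ⨅ t : {t : ℝ // 0 ≤ t}, (t.1 * x + ∑ i, max (p i - t.1 * γ i) 0)

/-- Right derivative `f'(x⁺)`. -/
noncomputable def rightD (f : ℝ → ℝ) (x : ℝ) : ℝ := derivWithin f (Set.Ici x) x

/-- Left derivative `f'(x⁻)`. -/
noncomputable def leftD (f : ℝ → ℝ) (x : ℝ) : ℝ := derivWithin f (Set.Iic x) x

/-- `Γ_l = Σ_{i ≤ l} γ_{π(i)}` (sum of the first `l` Gibbs weights in the order `π`). -/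
noncomputable def gammaPartial {d : ℕ} (γ : Fin d → ℝ) (π : Equiv.Perm (Fin d)) (l : ℕ) : ℝ :=
  ∑ i : Fin d, if (i : ℕ) < l then γ (π i) else 0

/-- The `l`-th β-ordered slope `s_l(p) = p_{π(l)}/γ_{π(l)}` (`l` is 1-indexed). -/
noncomputable def slopeAt {d : ℕ} (γ p : Fin d → ℝ) (π : Equiv.Perm (Fin d)) (l : ℕ) : ℝ :=
  if h : l - 1 < d then p (π ⟨l - 1, h⟩) / γ (π ⟨l - 1, h⟩) else 0

theorem gP_succ {d : ℕ} (γ : Fin d → ℝ) (π : Equiv.Perm (Fin d)) (k : Fin d) :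
    gammaPartial γ π (k + 1) = gammaPartial γ π k + γ (π k) := by
  unfold gammaPartial
  have h : γ (π k) = ∑ i : Fin d, if i = k then γ (π i) else 0 := by simp
  rw [h, ← Finset.sum_add_distrib]
  refine Finset.sum_congr rfl fun i _ => ?_
  by_cases h1 : i = k
  · subst h1; simp
  · have h2 : (i : ℕ) ≠ k := fun h => h1 (Fin.ext h)
    have h3 : ((i : ℕ) < k + 1) ↔ (i : ℕ) < k := by omega
    simp [h1, h3]

theorem gP_zero {d : ℕ} (γ : Fin d → ℝ) (π : Equiv.Perm (Fin d)) :
    gammaPartial γ π 0 = 0 := by simp [gammaPartial]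

theorem gP_top {d : ℕ} (γ : Fin d → ℝ) (π : Equiv.Perm (Fin d)) :
    gammaPartial γ π d = ∑ i, γ i := by
  simp [gammaPartial, Equiv.sum_comp π γ]

theorem curve_eq {d : ℕ} (γ p : Fin d → ℝ)
    (hγpos : ∀ i, 0 < γ i) (hppos : ∀ i, 0 < p i)
    (π : Equiv.Perm (Fin d))
    (hπ : ∀ a b : Fin d, a ≤ b → p (π b) / γ (π b) ≤ p (π a) / γ (π a))
    (k : Fin d) (x : ℝ) (hx1 : gammaPartial γ π k ≤ x) (hx2 : x ≤ gammaPartial γ π (k + 1)) :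
    tCurve γ p x = gammaPartial p π k + p (π k) / γ (π k) * (x - gammaPartial γ π k) := by
  have hg := hγpos (π k)
  rw [gP_succ] at hx2
  have key : ∀ t : {t : ℝ // 0 ≤ t},
      gammaPartial p π k + p (π k) / γ (π k) * (x - gammaPartial γ π k) ≤
        t.1 * x + ∑ i, max (p i - t.1 * γ i) 0 := by
    rintro ⟨t, ht⟩
    obtain ⟨θ, hθ⟩ : ∃ θ, θ = (x - gammaPartial γ π k) / γ (π k) := ⟨_, rfl⟩
    have hθ0 : 0 ≤ θ := by rw [hθ]; exact div_nonneg (by linarith) hg.le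
    have hθ1 : θ ≤ 1 := by rw [hθ, div_le_one hg]; linarith
    have hxe : x - gammaPartial γ π k = θ * γ (π k) := by rw [hθ]; field_simp
    have e1 : ∑ i, max (p i - t * γ i) 0 = ∑ i, max (p (π i) - t * γ (π i)) 0 :=
      (Equiv.sum_comp π (fun i => max (p i - t * γ i) 0)).symm
    have e2 : ∑ i : Fin d, (((if (i : ℕ) < k then p (π i) else 0)
        - t * (if (i : ℕ) < k then γ (π i) else 0))
        + (if i = k then θ * (p (π i) - t * γ (π i)) else 0))
        ≤ ∑ i, max (p (π i) - t * γ (π i)) 0 := by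
      refine Finset.sum_le_sum fun i _ => ?_
      by_cases h1 : i = k
      · subst h1
        simp only [lt_irrefl, if_false, if_true]
        rcases le_total 0 (p (π i) - t * γ (π i)) with h | h
        · rw [max_eq_left h]; nlinarith
        · rw [max_eq_right h]; nlinarith
      · by_cases h2 : (i : ℕ) < k
        · simp [h1, h2]
        · simp [h1, h2]
    rw [Finset.sum_add_distrib, Finset.sum_sub_distrib, ← Finset.mul_sum] at e2
    simp only [Finset.sum_ite_eq', Finset.mem_univ, if_true] at e2
    have e3 : p (π k) / γ (π k) * (x - gammaPartial γ π k) = θ * p (π k) := by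
      rw [hxe]; field_simp
    rw [e3]
    simp only []
    rw [e1]
    have hxe' : t * x = t * gammaPartial γ π k + t * (θ * γ (π k)) := by
      rw [← hxe]; ring
    change gammaPartial p π k - t * gammaPartial γ π k + _ ≤ _ at e2
    linarith
  have hs : 0 ≤ p (π k) / γ (π k) := (div_pos (hppos _) hg).le
  obtain ⟨s, hse⟩ : ∃ s, s = p (π k) / γ (π k) := ⟨_, rfl⟩
  have eqn : s * x + ∑ i, max (p i - s * γ i) 0
      = gammaPartial p π k + s * (x - gammaPartial γ π k) := by
    have e1 : ∑ i, max (p i - s * γ i) 0 = ∑ i, max (p (π i) - s * γ (π i)) 0 :=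
      (Equiv.sum_comp π (fun i => max (p i - s * γ i) 0)).symm
    have e2 : ∑ i, max (p (π i) - s * γ (π i)) 0
        = ∑ i : Fin d, ((if (i : ℕ) < k then p (π i) else 0)
        - s * (if (i : ℕ) < k then γ (π i) else 0)) := by
      refine Finset.sum_congr rfl fun i _ => ?_
      by_cases h2 : (i : ℕ) < k
      · have := hπ i k (le_of_lt h2)
        rw [← hse, le_div_iff₀ (hγpos _)] at this
        simp only [h2, if_true]
        exact max_eq_left (by linarith)
      · have := hπ k i (not_lt.mp h2)
        rw [← hse, div_le_iff₀ (hγpos _)] at this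
        simp only [h2, if_false]
        rw [max_eq_right (by linarith)]; ring
    rw [e1, e2, Finset.sum_sub_distrib, ← Finset.mul_sum]
    change s * x + (gammaPartial p π k - s * gammaPartial γ π k) = _
    ring
  unfold tCurve
  have : Nonempty {t : ℝ // 0 ≤ t} := ⟨⟨0, le_rfl⟩⟩
  refine le_antisymm ?_ (le_ciInf key)
  refine (ciInf_le ⟨_, by rintro _ ⟨t, rfl⟩; exact key t⟩ ⟨_, hs⟩).trans_eq ?_
  rw [hse] at eqn
  exact eqn

theorem right_eq {f : ℝ → ℝ} {a b c s x : ℝ} (h : ∀ y, a ≤ y → y ≤ b → f y = c + s * (y - a))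
    (h1 : a ≤ x) (h2 : x < b) : rightD f x = s := by
  have hd : HasDerivWithinAt (fun y => c + s * (y - a)) s (Set.Ici x) x := by
    have := ((((hasDerivAt_id x).sub_const a).const_mul s).const_add c).hasDerivWithinAt (s := Set.Ici x)
    simpa using this
  refine HasDerivWithinAt.derivWithin ?_ (uniqueDiffOn_Ici x x Set.self_mem_Ici)
  refine hd.congr_of_eventuallyEq ?_ (h x h1 h2.le)
  filter_upwards [Ico_mem_nhdsGE h2] with y hy
  exact h y (h1.trans hy.1) hy.2.le

theorem left_eq {f : ℝ → ℝ} {a b c s x : ℝ} (h : ∀ y, a ≤ y → y ≤ b → f y = c + s * (y - a))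
    (h1 : a < x) (h2 : x ≤ b) : leftD f x = s := by
  have hd : HasDerivWithinAt (fun y => c + s * (y - a)) s (Set.Iic x) x := by
    have := ((((hasDerivAt_id x).sub_const a).const_mul s).const_add c).hasDerivWithinAt (s := Set.Iic x)
    simpa using this
  refine HasDerivWithinAt.derivWithin ?_ (uniqueDiffOn_Iic x x Set.self_mem_Iic)
  refine hd.congr_of_eventuallyEq ?_ (h x h1.le h2)
  filter_upwards [Ioc_mem_nhdsLE h1] with y hy
  exact h y hy.1.le (hy.2.trans h2)

theorem slope_fin {d : ℕ} (γ p : Fin d → ℝ) (π : Equiv.Perm (Fin d)) (k : Fin d) :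
    slopeAt γ p π (k + 1) = p (π k) / γ (π k) := by
  simp [slopeAt]

/-- Interval-to-point optimisation, Lemma 2:
`sup_{x ∈ L} f'_p(x⁻)/f'_p(x⁺) = max_{l ∈ L'} s_l(p)/s_{l+1}(p)`. -/
theorem interval_to_point {d : ℕ} (hd : 2 ≤ d)
    (γ p q : Fin d → ℝ)
    (hγpos : ∀ i, 0 < γ i) (hγsum : ∑ i, γ i = 1)
    (hp : IsDist p) (hq : IsDist q) (hppos : ∀ i, 0 < p i)
    (hinc : ¬ ThermoMaj γ p q ∧ ¬ ThermoMaj γ q p)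
    (π : Equiv.Perm (Fin d))
    (hπ : ∀ a b : Fin d, a ≤ b → p (π b) / γ (π b) ≤ p (π a) / γ (π a))
    (L' : Finset ℕ)
    (hL'def : L' = (Finset.Icc 1 (d - 1)).filter fun l =>
      tCurve γ p (gammaPartial γ π l) < tCurve γ q (gammaPartial γ π l))
    (hL' : L'.Nonempty) :
    sSup ((fun x => leftD (tCurve γ p) x / rightD (tCurve γ p) x) ''
        {x : ℝ | x ∈ Set.Ioo (0 : ℝ) 1 ∧ tCurve γ p x < tCurve γ q x}) =
      L'.sup' hL' fun l => slopeAt γ p π l / slopeAt γ p π (l + 1) := by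
  have hspos : ∀ k, 0 < p (π k) / γ (π k) := fun k => div_pos (hppos _) (hγpos _)
  have hcur := curve_eq γ p hγpos hppos π hπ
  have hlt : ∀ k : Fin d, gammaPartial γ π k < gammaPartial γ π (k + 1) := fun k => by
    rw [gP_succ]; linarith [hγpos (π k)]
  have hR : ∀ (k : Fin d) x, gammaPartial γ π k ≤ x → x < gammaPartial γ π (k + 1) →
      rightD (tCurve γ p) x = p (π k) / γ (π k) := fun k x h1 h2 => right_eq (hcur k) h1 h2
  have hLd : ∀ (k : Fin d) x, gammaPartial γ π k < x → x ≤ gammaPartial γ π (k + 1) →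
      leftD (tCurve γ p) x = p (π k) / γ (π k) := fun k x h1 h2 => left_eq (hcur k) h1 h2
  have hmem : ∀ l, l ∈ L' ↔ (1 ≤ l ∧ l ≤ d - 1) ∧
      tCurve γ p (gammaPartial γ π l) < tCurve γ q (gammaPartial γ π l) := by
    intro l; rw [hL'def]; simp
  have hratio : ∀ l, 1 ≤ l → l ≤ d - 1 →
      leftD (tCurve γ p) (gammaPartial γ π l) / rightD (tCurve γ p) (gammaPartial γ π l)
        = slopeAt γ p π l / slopeAt γ p π (l + 1) := by
    intro l h1 h2
    obtain ⟨m, rfl⟩ : ∃ m, l = m + 1 := ⟨l - 1, by omega⟩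
    have a := hLd ⟨m, by omega⟩ _ (hlt ⟨m, by omega⟩) le_rfl
    have b := hR ⟨m + 1, by omega⟩ _ le_rfl (hlt ⟨m + 1, by omega⟩)
    have c := slope_fin γ p π ⟨m, by omega⟩
    have e := slope_fin γ p π ⟨m + 1, by omega⟩
    simp only [] at a b c e
    rw [a, b, c, e]
  have hone : ∀ l, 1 ≤ l → l ≤ d - 1 → 1 ≤ slopeAt γ p π l / slopeAt γ p π (l + 1) := by
    intro l h1 h2
    obtain ⟨m, rfl⟩ : ∃ m, l = m + 1 := ⟨l - 1, by omega⟩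
    have c := slope_fin γ p π ⟨m, by omega⟩
    have e := slope_fin γ p π ⟨m + 1, by omega⟩
    simp only [] at c e
    rw [c, e, one_le_div (hspos _)]
    exact hπ _ _ (by simp [Fin.le_def])
  have hmono : ∀ n, n ≤ d → ∀ m, m ≤ n → gammaPartial γ π m ≤ gammaPartial γ π n := by
    intro n _ m hmn
    unfold gammaPartial
    refine Finset.sum_le_sum fun i _ => ?_
    have := (hγpos (π i)).le
    split_ifs <;> first | omega | linarith
  have htop : gammaPartial γ π d = 1 := by rw [gP_top, hγsum]
  refine IsGreatest.csSup_eq ⟨?_, ?_⟩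
  · obtain ⟨l, hl, he⟩ := Finset.exists_mem_eq_sup' hL'
      fun l => slopeAt γ p π l / slopeAt γ p π (l + 1)
    rw [he]
    obtain ⟨⟨h1, h2⟩, h3⟩ := (hmem l).1 hl
    refine ⟨gammaPartial γ π l, ⟨⟨?_, ?_⟩, h3⟩, hratio l h1 h2⟩
    · have a := hlt ⟨0, by omega⟩
      have b := hmono l (by omega) 1 h1
      simp only [gP_zero, zero_add] at a
      linarith
    · have a := hlt ⟨l, by omega⟩
      have b := hmono d le_rfl (l + 1) (by omega)
      simp only [] at a
      linarith
  · rintro _ ⟨x, ⟨⟨hx0, hx1⟩, hx⟩, rfl⟩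
    have hex : ∃ n, x ≤ gammaPartial γ π n := ⟨d, by rw [htop]; exact hx1.le⟩
    obtain ⟨n, hn, hmin⟩ : ∃ n, x ≤ gammaPartial γ π n ∧ ∀ m < n, ¬ x ≤ gammaPartial γ π m :=
      ⟨Nat.find hex, Nat.find_spec hex, fun m hm => Nat.find_min hex hm⟩
    have hn0 : n ≠ 0 := by
      rintro rfl; rw [gP_zero] at hn; linarith
    have hnd : n ≤ d := by
      by_contra h
      exact hmin d (by omega) (by rw [htop]; exact hx1.le)
    obtain ⟨m, rfl⟩ : ∃ m, n = m + 1 := ⟨n - 1, by omega⟩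
    have hm := not_le.1 (hmin m (by omega))
    rcases hn.lt_or_eq with h | h
    · have a := hLd ⟨m, by omega⟩ x hm h.le
      have b := hR ⟨m, by omega⟩ x hm.le h
      simp only []
      rw [a, b, div_self (hspos _).ne']
      obtain ⟨l, hl⟩ := hL'
      obtain ⟨⟨h1, h2⟩, h3⟩ := (hmem l).1 hl
      exact (hone l h1 h2).trans
        (Finset.le_sup' (fun l => slopeAt γ p π l / slopeAt γ p π (l + 1)) hl)
    · have hmd : m + 1 ≠ d := by
        intro e; rw [e, htop] at h; linarith
      subst h
      simp only []
      rw [hratio (m + 1) (by omega) (by omega)]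
      exact Finset.le_sup' (fun l => slopeAt γ p π l / slopeAt γ p π (l + 1))
        ((hmem (m + 1)).2 ⟨⟨by omega, by omega⟩, hx⟩)
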